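/- Effective permeability of a medium with two pore-networks: fix μ, k₁, k₂ > 0 and set η := √(μ(k₁+k₂)/(k₁k₂)). Let (u₁, u₂, p₁, p₂), with each function continuous on [0,1] and differentiable on (0,1), satisfy the non-dimensional one-dimensional double porosity/permeability system on (0,1) together with the boundary conditions p₁(0) = 1, p₁(1) = 0, u₂(0) = 0, and u₂(1) = 0. Then the total discharge u₁(x) + u₂(x) is the same for every x ∈ [0,1], and μ·u₁(0) = (k₁ + k₂)/( 2·tanh(η/2)·k₂/(k₁η) + 1 ); that is, the effective permeability measured in a standard permeability experiment equals k_eff = (k₁ + k₂)/( 2·tanh(η/2)·k₂/(k₁η) + 1 ). -/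

import Mathlib

open Set

/-- A function continuous on `[a, b]` with zero derivative on `(a, b)` is constant on `[a, b]`. -/
theorem eq_left_of_hasDerivAt_zero_Ioo {f : ℝ → ℝ} {a b : ℝ} (hf : ContinuousOn f (Icc a b))
    (hf' : ∀ x ∈ Ioo a b, HasDerivAt f 0 x) {x : ℝ} (hx : x ∈ Icc a b) : f x = f a := by
  rcases hx.1.eq_or_lt with rfl | h
  · rfl
  obtain ⟨c, -, hc⟩ := exists_hasDerivAt_eq_slope f (fun _ => 0) h
    (hf.mono (Icc_subset_Icc_right hx.2)) fun y hy => hf' y ⟨hy.1, hy.2.trans_le hx.2⟩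
  have := (div_eq_zero_iff.mp hc.symm).resolve_right (sub_pos.mpr h).ne'
  linarith

/-- If `v' = q` and `q' = η² v` on `(0, 1)`, then `(q - η v) exp (η x)` takes the same
value at both endpoints. -/
theorem sub_mul_exp_eq_of_hasDerivAt {v q : ℝ → ℝ} {η : ℝ}
    (hv : ContinuousOn v (Icc 0 1)) (hq : ContinuousOn q (Icc 0 1))
    (hv' : ∀ x ∈ Ioo (0:ℝ) 1, HasDerivAt v (q x) x)
    (hq' : ∀ x ∈ Ioo (0:ℝ) 1, HasDerivAt q (η ^ 2 * v x) x) :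
    (q 1 - η * v 1) * Real.exp η = q 0 - η * v 0 := by
  have h := eq_left_of_hasDerivAt_zero_Ioo (f := fun x => (q x - η * v x) * Real.exp (η * x))
    (by fun_prop) (fun x hx => by
      have hexp : HasDerivAt (fun y => Real.exp (η * y)) (Real.exp (η * x) * (η * 1)) x :=
        ((hasDerivAt_id x).const_mul η).exp
      refine (((hq' x hx).sub ((hv' x hx).const_mul η)).mul hexp).congr_deriv ?_
      simp only [Pi.sub_apply]
      ring) (right_mem_Icc.mpr zero_le_one)
  simpa using h

/-- For `v' = q` and `q' = η² v` on `(0, 1)` with equal boundary values `v 0 = v 1`, the jump of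
`q` across the interval. -/
theorem sub_eq_two_mul_tanh_of_hasDerivAt {v q : ℝ → ℝ} {η : ℝ} (hη : 0 < η)
    (hv : ContinuousOn v (Icc 0 1)) (hq : ContinuousOn q (Icc 0 1))
    (hv' : ∀ x ∈ Ioo (0:ℝ) 1, HasDerivAt v (q x) x)
    (hq' : ∀ x ∈ Ioo (0:ℝ) 1, HasDerivAt q (η ^ 2 * v x) x) (hbc : v 1 = v 0) :
    q 1 - q 0 = 2 * η * v 0 * Real.tanh (η / 2) := by
  have hminus := sub_mul_exp_eq_of_hasDerivAt hv hq hv' hq'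
  have hplus := sub_mul_exp_eq_of_hasDerivAt (η := -η) hv hq hv' (by simpa using hq')
  rw [hbc, Real.exp_neg] at hplus
  rw [hbc] at hminus
  have hE : 1 < Real.exp η := Real.one_lt_exp_iff.mpr hη
  have htanh : Real.tanh (η / 2) = (Real.exp η - 1) / (Real.exp η + 1) := by
    have hsq : Real.exp η = Real.exp (η / 2) ^ 2 := by rw [← Real.exp_nat_mul]; ring_nf
    have := Real.exp_pos (η / 2)
    rw [Real.tanh_eq, Real.exp_neg, hsq]
    field_simp
  rw [htanh]
  generalize Real.exp η = E at *
  have hE0 : E ≠ 0 := by positivity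
  have hE1 : E - 1 ≠ 0 := (sub_pos.mpr hE).ne'
  have hE2 : E + 1 ≠ 0 := by positivity
  field_simp at hplus ⊢
  apply mul_left_cancel₀ hE1
  linear_combination (E - 1) * hminus + (E - 1) * hplus

/-- Effective permeability of a medium with two pore-networks: for the
solution of the non-dimensional one-dimensional double porosity/permeability system with
`p₁(0) = 1`, `p₁(1) = 0` and no-flux micro-pore boundary conditions, the total discharge
`u₁ + u₂` is constant on `[0,1]`, and the effective permeability measured in a standard
permeability experiment is `μ·u₁(0) = (k₁ + k₂)/(2·tanh(η/2)·k₂/(k₁η) + 1)`. -/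
theorem effective_permeability
    (μ k₁ k₂ η : ℝ) (hμ : 0 < μ) (hk₁ : 0 < k₁) (hk₂ : 0 < k₂)
    (hη : η = Real.sqrt (μ * (k₁ + k₂) / (k₁ * k₂)))
    (u₁ u₂ p₁ p₂ : ℝ → ℝ)
    (hcont : ∀ f ∈ [u₁, u₂, p₁, p₂], ContinuousOn f (Icc 0 1))
    (hdiff : ∀ f ∈ [u₁, u₂, p₁, p₂], ∀ x ∈ Ioo (0:ℝ) 1, DifferentiableAt ℝ f x)
    (heq₁ : ∀ x ∈ Ioo (0:ℝ) 1, μ / k₁ * u₁ x + deriv p₁ x = 0)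
    (heq₂ : ∀ x ∈ Ioo (0:ℝ) 1, deriv u₁ x = -(p₁ x - p₂ x))
    (heq₃ : ∀ x ∈ Ioo (0:ℝ) 1, μ / k₂ * u₂ x + deriv p₂ x = 0)
    (heq₄ : ∀ x ∈ Ioo (0:ℝ) 1, deriv u₂ x = p₁ x - p₂ x)
    (hbc₁ : p₁ 0 = 1) (hbc₂ : p₁ 1 = 0)
    (hbc₃ : u₂ 0 = 0) (hbc₄ : u₂ 1 = 0) :
    (∀ x ∈ Icc (0:ℝ) 1, u₁ x + u₂ x = u₁ 0 + u₂ 0) ∧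
    μ * u₁ 0 = (k₁ + k₂) / (2 * Real.tanh (η / 2) * (k₂ / (k₁ * η)) + 1) := by
  simp only [List.forall_mem_cons, List.not_mem_nil, false_imp_iff, implies_true,
    and_true] at hcont hdiff
  obtain ⟨cu₁, cu₂, cp₁, cp₂⟩ := hcont
  obtain ⟨du₁, du₂, dp₁, dp₂⟩ := hdiff
  have hu₁ x (hx : x ∈ Ioo (0:ℝ) 1) : HasDerivAt u₁ (-(p₁ x - p₂ x)) x :=
    heq₂ x hx ▸ (du₁ x hx).hasDerivAt
  have hu₂ x (hx : x ∈ Ioo (0:ℝ) 1) : HasDerivAt u₂ (p₁ x - p₂ x) x :=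
    heq₄ x hx ▸ (du₂ x hx).hasDerivAt
  have hp₁ x (hx : x ∈ Ioo (0:ℝ) 1) : HasDerivAt p₁ (-(μ / k₁ * u₁ x)) x :=
    (dp₁ x hx).hasDerivAt.congr_deriv (by linarith [heq₁ x hx])
  have hp₂ x (hx : x ∈ Ioo (0:ℝ) 1) : HasDerivAt p₂ (-(μ / k₂ * u₂ x)) x :=
    (dp₂ x hx).hasDerivAt.congr_deriv (by linarith [heq₃ x hx])
  have hsum x (hx : x ∈ Icc (0:ℝ) 1) : u₁ x + u₂ x = u₁ 0 + u₂ 0 :=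
    eq_left_of_hasDerivAt_zero_Ioo (f := fun x => u₁ x + u₂ x) (by fun_prop)
      (fun y hy => ((hu₁ y hy).add (hu₂ y hy)).congr_deriv (by ring)) hx
  refine ⟨hsum, ?_⟩
  have hη0 : 0 < η := hη ▸ Real.sqrt_pos.mpr (by positivity)
  have hη2 : η ^ 2 = μ * (k₁ + k₂) / (k₁ * k₂) := hη ▸ Real.sq_sqrt (by positivity)
  have hu₁_eq x (hx : x ∈ Ioo (0:ℝ) 1) : u₁ x = u₁ 0 - u₂ x := by
    linarith [hsum x (Ioo_subset_Icc_self hx)]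
  have hflux := eq_left_of_hasDerivAt_zero_Ioo
    (f := fun x => k₁ * p₁ x + k₂ * p₂ x + μ * u₁ 0 * x) (by fun_prop)
    (fun x hx => ((((hp₁ x hx).const_mul k₁).add ((hp₂ x hx).const_mul k₂)).add
      ((hasDerivAt_id x).const_mul (μ * u₁ 0))).congr_deriv (by
        rw [hu₁_eq x hx]
        field_simp
        ring)) (right_mem_Icc.mpr zero_le_one)
  have hjump := sub_eq_two_mul_tanh_of_hasDerivAt (v := fun x => u₂ x - k₂ * u₁ 0 / (k₁ + k₂))
    (q := fun x => p₁ x - p₂ x) hη0 (by fun_prop) (by fun_prop)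
    (fun x hx => (hu₂ x hx).sub_const _)
    (fun x hx => ((hp₁ x hx).sub (hp₂ x hx)).congr_deriv (by
      rw [hu₁_eq x hx, hη2]
      field_simp
      ring)) (by simp only [hbc₃, hbc₄])
  simp only [hbc₁, hbc₂, hbc₃] at hflux hjump
  have ht : 0 < Real.tanh (η / 2) := by
    rw [Real.tanh_eq_sinh_div_cosh]
    exact div_pos (Real.sinh_pos_iff.mpr (by positivity)) (Real.cosh_pos _)
  generalize Real.tanh (η / 2) = t at *
  have hcoeff : μ * (k₂ / (k₁ * η)) = k₂ * η * (k₂ / (k₁ + k₂)) := by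
    field_simp at hη2 ⊢
    linear_combination -hη2
  rw [eq_div_iff (by positivity)]
  linear_combination 2 * t * u₁ 0 * hcoeff + hflux + k₂ * hjump
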